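/- Suppose Π(Ψ∖{ψ*}) > 0 for every ψ* ∈ Ψ, and let R(ψ*) = {x : m_{ψ*}(x) ≤ m(x)}. Then ∫_Ψ M_{ψ*}(R(ψ*)) Π(dψ*) ≤ ∫_Ψ [ ∫_{Ψ∖{ψ*}} M_ψ(R(ψ*)) Π(dψ) / Π(Ψ∖{ψ*}) ] Π(dψ*). Equivalently, the prior probability that the plausible region Pl covers the true value is always greater than or equal to the prior probability that Pl covers a false value, in the sense that E_{Π(dψ*)}[M_{ψ*}(ψ* ∈ Pl(X))] ≥ E_{Π(dψ*)}[ (Π(Ψ∖{ψ*}))^{-1} ∫_{Ψ∖{ψ*}} M_ψ(ψ* ∈ Pl(X)) Π(dψ) ]. -/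

import Mathlib

open MeasureTheory
open scoped ENNReal

theorem restrict_compl_singleton_of_not_measurableSet {α : Type*} [MeasurableSpace α]
    (ν : Measure α) [IsFiniteMeasure ν] {a : α} (ha : ¬ MeasurableSet ({a} : Set α)) :
    ν.restrict {a}ᶜ = ν := by
  have hT : toMeasurable ν ({a}ᶜ : Set α) = Set.univ := by
    have hsub := subset_toMeasurable ν ({a}ᶜ : Set α)
    have hmeas := measurableSet_toMeasurable ν ({a}ᶜ : Set α)
    refine Set.eq_univ_of_forall fun x => ?_
    by_contra hx
    have hxa : x = a := by
      by_contra hne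
      exact hx (hsub hne)
    subst hxa
    refine ha (MeasurableSet.compl_iff.1 ?_)
    convert hmeas using 1
    exact hsub.antisymm fun y hy hyx => hx (hyx ▸ hy)
  rw [← Measure.restrict_toMeasurable (measure_ne_top ν _), hT, Measure.restrict_univ]

/-- Splitting off the contribution of a point, which need not be a measurable set. -/
theorem exists_lintegral_eq_setLIntegral_compl_singleton_add {α : Type*} [MeasurableSpace α]
    (ν : Measure α) [IsProbabilityMeasure ν] (a : α) (g : α → ℝ≥0∞) :
    ∃ c, ν {a}ᶜ + c = 1 ∧ ∫⁻ x, g x ∂ν = ∫⁻ x in {a}ᶜ, g x ∂ν + g a * c := by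
  by_cases ha : MeasurableSet ({a} : Set α)
  · refine ⟨ν {a}, ?_, ?_⟩
    · rw [add_comm, measure_add_measure_compl ha, measure_univ]
    · rw [← lintegral_add_compl g ha, add_comm]
      congr 1
      rw [setLIntegral_congr_fun (g := fun _ => g a) ha (fun x hx => by
        rw [Set.mem_singleton_iff.1 hx]), setLIntegral_const]
  · have h := restrict_compl_singleton_of_not_measurableSet ν ha
    refine ⟨0, ?_, by rw [h, mul_zero, add_zero]⟩
    rw [add_zero, ← Measure.restrict_apply_univ, h, measure_univ]

theorem le_setLIntegral_compl_singleton_div {α : Type*} [MeasurableSpace α]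
    (ν : Measure α) [IsProbabilityMeasure ν] {a : α} {g : α → ℝ≥0∞} (hfin : g a ≠ ∞)
    (hpos : 0 < ν {a}ᶜ) (h : g a ≤ ∫⁻ x, g x ∂ν) :
    g a ≤ (∫⁻ x in {a}ᶜ, g x ∂ν) / ν {a}ᶜ := by
  obtain ⟨c, hc, hg⟩ := exists_lintegral_eq_setLIntegral_compl_singleton_add ν a g
  have hcfin : c ≠ ∞ := by
    rintro rfl
    simp at hc
  rw [ENNReal.le_div_iff_mul_le (.inl hpos.ne') (.inl (measure_ne_top ν _))]
  refine (ENNReal.add_le_add_iff_right (ENNReal.mul_ne_top hfin hcfin)).1 ?_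
  rwa [← mul_add, hc, mul_one, ← hg]

theorem setLIntegral_compl_singleton_div_le {α : Type*} [MeasurableSpace α]
    (ν : Measure α) [IsProbabilityMeasure ν] {a : α} {g : α → ℝ≥0∞} (hfin : g a ≠ ∞)
    (hpos : 0 < ν {a}ᶜ) (h : ∫⁻ x, g x ∂ν ≤ g a) :
    (∫⁻ x in {a}ᶜ, g x ∂ν) / ν {a}ᶜ ≤ g a := by
  obtain ⟨c, hc, hg⟩ := exists_lintegral_eq_setLIntegral_compl_singleton_add ν a g
  have hcfin : c ≠ ∞ := by
    rintro rfl
    simp at hc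
  rw [ENNReal.div_le_iff hpos.ne' (measure_ne_top ν _)]
  refine (ENNReal.add_le_add_iff_right (ENNReal.mul_ne_top hfin hcfin)).1 ?_
  rwa [← mul_add, hc, mul_one, ← hg]

theorem lintegral_withDensity_apply_swap {X Ψ : Type*} [MeasurableSpace X] [MeasurableSpace Ψ]
    (μ : Measure X) [SFinite μ] (ν : Measure Ψ) [SFinite ν]
    {m : Ψ → X → ℝ≥0∞} (hm : Measurable (Function.uncurry m)) {A : Set X}
    (hA : MeasurableSet A) :
    ∫⁻ ψ, μ.withDensity (m ψ) A ∂ν = ∫⁻ x in A, ∫⁻ ψ, m ψ x ∂ν ∂μ := by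
  simp_rw [withDensity_apply _ hA]
  exact lintegral_lintegral_swap hm.aemeasurable

/-- **Theorem 3(ii)** (Evans–Guo): suppose `Π(Ψ∖{ψ*}) > 0` for every `ψ*` and let
`R(ψ*) = {x | m_{ψ*}(x) ≤ m(x)}`, so `Pl(x) = {ψ | m_ψ(x) > m(x)}` and
`{x | ψ* ∈ Pl(x)} = R(ψ*)ᶜ`. Then
`∫ M_{ψ*}(R(ψ*)) Π(dψ*) ≤ ∫ [∫_{Ψ∖{ψ*}} M_ψ(R(ψ*)) Π(dψ) / Π(Ψ∖{ψ*})] Π(dψ*)`;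
equivalently, the prior probability that the plausible region covers the true value is at
least the prior probability that it covers a false value. -/
theorem plausible_region_covers_true_more_than_false
    {X Ψ : Type*} [MeasurableSpace X] [MeasurableSpace Ψ]
    (μ : Measure X) [SigmaFinite μ]
    (Pr : Measure Ψ) [IsProbabilityMeasure Pr]
    (m : Ψ → X → ℝ≥0∞) (hm : Measurable (Function.uncurry m))
    (hprob : ∀ ψ, IsProbabilityMeasure (μ.withDensity (m ψ)))
    (mbar : X → ℝ≥0∞) (hmbar : ∀ x, mbar x = ∫⁻ ψ, m ψ x ∂Pr)
    (hpos : ∀ ψs : Ψ, 0 < Pr {ψs}ᶜ) :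
    (∫⁻ ψs, μ.withDensity (m ψs) {x | m ψs x ≤ mbar x} ∂Pr ≤
      ∫⁻ ψs, (∫⁻ ψ in {ψs}ᶜ, μ.withDensity (m ψ) {x | m ψs x ≤ mbar x} ∂Pr) /
        Pr {ψs}ᶜ ∂Pr) ∧
    (∫⁻ ψs, (∫⁻ ψ in {ψs}ᶜ, μ.withDensity (m ψ) {x | mbar x < m ψs x} ∂Pr) /
        Pr {ψs}ᶜ ∂Pr ≤
      ∫⁻ ψs, μ.withDensity (m ψs) {x | mbar x < m ψs x} ∂Pr) := by
  have hmψ : ∀ ψ, Measurable (m ψ) := fun ψ => hm.of_uncurry_left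
  have hmb : Measurable mbar := by
    rw [funext hmbar]
    exact hm.lintegral_prod_left'
  have hswap : ∀ A, MeasurableSet A →
      ∫⁻ ψ, μ.withDensity (m ψ) A ∂Pr = ∫⁻ x in A, mbar x ∂μ := fun A hA => by
    simp_rw [hmbar]
    exact lintegral_withDensity_apply_swap μ Pr hm hA
  constructor
  · refine lintegral_mono fun ψs => ?_
    have hA : MeasurableSet {x | m ψs x ≤ mbar x} := measurableSet_le (hmψ ψs) hmb
    refine le_setLIntegral_compl_singleton_div Pr
      (g := fun ψ => μ.withDensity (m ψ) {x | m ψs x ≤ mbar x})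
      (measure_ne_top _ _) (hpos ψs) ?_
    rw [hswap _ hA, withDensity_apply _ hA]
    exact setLIntegral_mono' hA fun x hx => hx
  · refine lintegral_mono fun ψs => ?_
    have hA : MeasurableSet {x | mbar x < m ψs x} := measurableSet_lt hmb (hmψ ψs)
    refine setLIntegral_compl_singleton_div_le Pr
      (g := fun ψ => μ.withDensity (m ψ) {x | mbar x < m ψs x})
      (measure_ne_top _ _) (hpos ψs) ?_
    rw [hswap _ hA, withDensity_apply _ hA]
    exact setLIntegral_mono' hA fun x hx => le_of_lt hx
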